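/- (Modified Smith form) Let k be a field and n ≥ 1. For every M ∈ M_n(k[x]) there exist matrices U, V ∈ B_n (invertible over k[x] with U(0), V(0) upper unitriangular), a permutation σ ∈ S_n, and a diagonal matrix D ∈ M_n(k[x]) such that M = U D M_σ V, where M_σ is the permutation matrix (M_σ)_{ij} = δ_{σ(i),j}. -/

import Mathlib

open Polynomial in
theorem sm_deg {k : Type*} [Field k] (p a : k[X]) (ha : a.natDegree ≠ 0)
    (h : a.natDegree ≤ p.natDegree) : (p + -(p / a) * a).natDegree < p.natDegree := by
  have : p + -(p / a) * a = p % a := by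
    have := EuclideanDomain.div_add_mod p a
    linear_combination -this
  rw [this]
  exact lt_of_lt_of_le (Polynomial.natDegree_mod_lt p ha) h

open Polynomial in
theorem sm_Xdeg {k : Type*} [Field k] (p q : k[X]) (hp : p.eval 0 ≠ 0) (hq : ¬ p ∣ q) :
    (X * (q % p)).natDegree ≠ 0 ∧ (X * (q % p)).natDegree ≤ p.natDegree := by
  have h0 : q % p ≠ 0 := fun h => hq ((EuclideanDomain.mod_eq_zero).1 h)
  have hp0 : p.natDegree ≠ 0 := by
    intro h
    apply hq
    rw [Polynomial.eq_C_of_natDegree_eq_zero h] at hp ⊢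
    have : p.coeff 0 ≠ 0 := by simpa using hp
    exact (Polynomial.isUnit_C.2 (isUnit_iff_ne_zero.2 this)).dvd
  have := Polynomial.natDegree_mod_lt q hp0
  rw [Polynomial.natDegree_X_mul h0]
  omega

open Polynomial in
theorem sm_L2 {k : Type*} [Field k] (p q : k[X]) (hp : p.eval 0 ≠ 0) (hq : ¬ p ∣ q) :
    ∃ s t : k[X], t.eval 0 = 0 ∧ (p + t * (q + s * p)).natDegree < p.natDegree := by
  obtain ⟨h1, h2⟩ := sm_Xdeg p q hp hq
  refine ⟨-(q / p), X * -(p / (X * (q % p))), by simp, ?_⟩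
  have := sm_deg p _ h1 h2
  have e : q + -(q / p) * p = q % p := by
    linear_combination - EuclideanDomain.div_add_mod q p
  rw [e]
  convert this using 2
  ring

open Polynomial in
theorem sm_L1 {k : Type*} [Field k] (p q : k[X]) (hp : p.eval 0 ≠ 0) (hq : ¬ p ∣ q)
    (hq0 : q.eval 0 = 0) :
    ∃ s t : k[X], s.eval 0 = 0 ∧ (p + t * (q + s * p)).natDegree < p.natDegree := by
  have : X ∣ q := by
    rw [Polynomial.X_dvd_iff, Polynomial.coeff_zero_eq_eval_zero, hq0]
  obtain ⟨q', rfl⟩ := this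
  have hq' : ¬ p ∣ q' := fun h => hq (h.mul_left _)
  obtain ⟨h1, h2⟩ := sm_Xdeg p q' hp hq'
  refine ⟨-(X * (q' / p)), -(p / (X * (q' % p))), by simp, ?_⟩
  have := sm_deg p _ h1 h2
  have e : X * q' + -(X * (q' / p)) * p = X * (q' % p) := by
    linear_combination - X * EuclideanDomain.div_add_mod q' p
  rw [e]
  exact this

/-- The group `B`, indexed by a finite linear order. -/
def SmB {k : Type*} [Field k] {ι : Type} [Fintype ι] [LinearOrder ι]
    (U : Matrix ι ι (Polynomial k)) : Prop :=
  IsUnit U ∧ (∀ i, (U i i).eval 0 = 1) ∧ (∀ i j, j < i → (U i j).eval 0 = 0)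

section
variable {k : Type*} [Field k] {ι κ : Type} [Fintype ι] [LinearOrder ι] [Fintype κ] [LinearOrder κ]

theorem SmB.one : SmB (1 : Matrix ι ι (Polynomial k)) := by
  refine ⟨isUnit_one, fun i => by simp, fun i j h => ?_⟩
  rw [Matrix.one_apply_ne h.ne']; simp

theorem SmB.mul {U V : Matrix ι ι (Polynomial k)} (hU : SmB U) (hV : SmB V) : SmB (U * V) := by
  obtain ⟨a, b, c⟩ := hU
  obtain ⟨a', b', c'⟩ := hV
  refine ⟨a.mul a', fun i => ?_, fun i j h => ?_⟩
  · rw [Matrix.mul_apply, Polynomial.eval_finsetSum, Finset.sum_eq_single i]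
    · simp [b, b']
    · intro l _ hl
      rcases lt_or_gt_of_ne hl with h | h
      · simp [c _ _ h]
      · simp [c' _ _ h]
    · simp
  · rw [Matrix.mul_apply, Polynomial.eval_finsetSum]
    apply Finset.sum_eq_zero
    intro l _
    rcases lt_or_ge l i with h1 | h1
    · simp [c _ _ h1]
    · simp [c' _ _ (h.trans_le h1)]

/-- `B × B` equivalence. -/
def SmE (M N : Matrix ι κ (Polynomial k)) : Prop :=
  ∃ (U : Matrix ι ι (Polynomial k)) (V : Matrix κ κ (Polynomial k)), SmB U ∧ SmB V ∧ M = U * N * V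

theorem SmE.refl (M : Matrix ι κ (Polynomial k)) : SmE M M :=
  ⟨1, 1, SmB.one, SmB.one, by simp⟩

theorem SmE.trans {M N P : Matrix ι κ (Polynomial k)} (h : SmE M N) (h' : SmE N P) : SmE M P := by
  obtain ⟨U, V, hU, hV, rfl⟩ := h
  obtain ⟨U', V', hU', hV', rfl⟩ := h'
  exact ⟨U * U', V' * V, hU.mul hU', hV'.mul hV, by simp only [Matrix.mul_assoc]⟩

theorem sm_vv (u v : ι → Polynomial k) (h : v ⬝ᵥ u = 0) :
    (1 + Matrix.vecMulVec u v) * (1 + Matrix.vecMulVec (-u) v) = 1 := by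
  rw [Matrix.mul_add, Matrix.add_mul, Matrix.add_mul, Matrix.vecMulVec_mul_vecMulVec]
  simp [h, Matrix.neg_vecMulVec]

/-- row operations: row `r` gets `t r` times row `a`. -/
theorem SmE.row (M : Matrix ι κ (Polynomial k)) (a : ι) (t : ι → Polynomial k) (ha : t a = 0)
    (ht : ∀ r, a < r → (t r).eval 0 = 0) :
    SmE M (Matrix.of fun r s => M r s + t r * M a s) := by
  have e : (Matrix.of fun r s => M r s + t r * M a s)
      = (1 + Matrix.vecMulVec t (Pi.single a 1)) * M := by
    ext1 r s
    rw [Matrix.add_mul, Matrix.add_apply, Matrix.one_mul]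
    simp [Matrix.mul_apply, Matrix.vecMulVec_apply, Pi.single_apply]
  have h1 := sm_vv (-t) (Pi.single a 1) (by simp [ha])
  rw [neg_neg] at h1
  refine ⟨1 + Matrix.vecMulVec (-t) (Pi.single a 1), 1, ⟨?_, ?_, ?_⟩, SmB.one, ?_⟩
  · exact IsUnit.of_mul_eq_one _ h1
  · intro i
    by_cases h : i = a
    · subst h; simp [Matrix.vecMulVec_apply, ha]
    · simp [Matrix.vecMulVec_apply, h]
  · intro i j hij
    by_cases h : j = a
    · subst h; simp [Matrix.vecMulVec_apply, ht _ hij, Matrix.one_apply_ne hij.ne']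
    · simp [Matrix.vecMulVec_apply, h, Matrix.one_apply_ne hij.ne']
  · rw [e, ← Matrix.mul_assoc, h1]; simp

/-- column operations: column `s` gets `t s` times column `a`. -/
theorem SmE.col (M : Matrix ι κ (Polynomial k)) (a : κ) (t : κ → Polynomial k) (ha : t a = 0)
    (ht : ∀ s, s < a → (t s).eval 0 = 0) :
    SmE M (Matrix.of fun r s => M r s + M r a * t s) := by
  have e : (Matrix.of fun r s => M r s + M r a * t s)
      = M * (1 + Matrix.vecMulVec (Pi.single a 1) t) := by
    ext1 r s
    rw [Matrix.mul_add, Matrix.add_apply, Matrix.mul_one]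
    simp [Matrix.mul_apply, Matrix.vecMulVec_apply, Pi.single_apply]
  have h1 := sm_vv (Pi.single a 1) t (by simp [ha])
  rw [Matrix.neg_vecMulVec, ← Matrix.vecMulVec_neg] at h1
  refine ⟨1, 1 + Matrix.vecMulVec (Pi.single a 1) (-t), SmB.one, ⟨?_, ?_, ?_⟩, ?_⟩
  · exact IsUnit.of_mul_eq_one_right _ h1
  · intro i
    by_cases h : i = a
    · subst h; simp [Matrix.vecMulVec_apply, ha]
    · simp [Matrix.vecMulVec_apply, h]
  · intro i j hij
    by_cases h : i = a
    · subst h; simp [Matrix.vecMulVec_apply, ht _ hij, Matrix.one_apply_ne hij.ne']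
    · simp [Matrix.vecMulVec_apply, h, Matrix.one_apply_ne hij.ne']
  · rw [e, Matrix.one_mul, Matrix.mul_assoc, h1]; simp

/-- pivot condition. -/
def SmP (i : ι) (j : κ) (N : Matrix ι κ (Polynomial k)) : Prop :=
  (N i j).eval 0 ≠ 0 ∧ (∀ r s, s < j → (N r s).eval 0 = 0) ∧ ∀ r, i < r → (N r j).eval 0 = 0

theorem SmP.row {i : ι} {j : κ} {N : Matrix ι κ (Polynomial k)} (h : SmP i j N)
    (a : ι) (t : ι → Polynomial k) (ha : t a = 0)
    (ht : ∀ r, a < r → (t r).eval 0 = 0) :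
    SmP i j (Matrix.of fun r s => N r s + t r * N a s) := by
  obtain ⟨h1, h2, h3⟩ := h
  have key : ∀ r, i ≤ r → (t r * N a j).eval 0 = 0 := by
    intro r hr
    rcases lt_trichotomy a r with h | h | h
    · simp [ht _ h]
    · subst h; simp [ha]
    · simp [h3 _ (hr.trans_lt h)]
  refine ⟨?_, ?_, ?_⟩
  · simpa [Polynomial.eval_add, key i le_rfl, -Polynomial.eval_mul] using h1
  · intro r s hs
    simp [h2 _ _ hs]
  · intro r hr
    simp [h3 _ hr, key r hr.le, -Polynomial.eval_mul]

theorem SmP.col {i : ι} {j : κ} {N : Matrix ι κ (Polynomial k)} (h : SmP i j N)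
    (a : κ) (t : κ → Polynomial k) (ha : t a = 0)
    (ht : ∀ r, r < a → (t r).eval 0 = 0) :
    SmP i j (Matrix.of fun r s => N r s + N r a * t s) := by
  obtain ⟨h1, h2, h3⟩ := h
  have key : ∀ r s, s ≤ j → (N r a * t s).eval 0 = 0 := by
    intro r s hs
    rcases lt_trichotomy a s with h | h | h
    · simp [h2 _ _ (h.trans_le hs)]
    · subst h; simp [ha]
    · simp [ht _ h]
  refine ⟨?_, ?_, ?_⟩
  · simpa [Polynomial.eval_add, key _ _ le_rfl, -Polynomial.eval_mul] using h1
  · intro r s hs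
    simp [h2 _ _ hs, key r s hs.le, -Polynomial.eval_mul]
  · intro r hr
    simp [h3 _ hr, key r j le_rfl, -Polynomial.eval_mul]

theorem sm_colstep {i : ι} {j : κ} {N : Matrix ι κ (Polynomial k)} (h : SmP i j N) (r : ι)
    (hr : ¬ N i j ∣ N r j) :
    ∃ N', SmE N N' ∧ SmP i j N' ∧ (N' i j).natDegree < (N i j).natDegree := by
  have hne : r ≠ i := by rintro rfl; exact hr dvd_rfl
  obtain ⟨s, t, hs, ht, hd⟩ : ∃ s t : Polynomial k, (i < r → s.eval 0 = 0) ∧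
      (r < i → t.eval 0 = 0) ∧
      (N i j + t * (N r j + s * N i j)).natDegree < (N i j).natDegree := by
    rcases lt_or_gt_of_ne hne with h' | h'
    · obtain ⟨s, t, a, b⟩ := sm_L2 _ _ h.1 hr
      exact ⟨s, t, fun h => absurd h h'.asymm, fun _ => a, b⟩
    · obtain ⟨s, t, a, b⟩ := sm_L1 _ _ h.1 hr (h.2.2 _ h')
      exact ⟨s, t, fun _ => a, fun h => absurd h h'.asymm, b⟩
  have a1 : (Pi.single r s : ι → Polynomial k) i = 0 := by simp [hne.symm]
  have a2 : ∀ l, i < l → ((Pi.single r s : ι → Polynomial k) l).eval 0 = 0 := by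
    intro l hl
    by_cases e : l = r
    · subst e; simpa using hs hl
    · simp [e]
  have b1 : (Pi.single i t : ι → Polynomial k) r = 0 := by simp [hne]
  have b2 : ∀ l, r < l → ((Pi.single i t : ι → Polynomial k) l).eval 0 = 0 := by
    intro l hl
    by_cases e : l = i
    · subst e; simpa using ht hl
    · simp [e]
  refine ⟨_, (SmE.row N i _ a1 a2).trans (SmE.row _ r _ b1 b2), (h.row i _ a1 a2).row r _ b1 b2, ?_⟩
  simpa [hne.symm] using hd

theorem sm_rowstep {i : ι} {j : κ} {N : Matrix ι κ (Polynomial k)} (h : SmP i j N) (r : κ)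
    (hr : ¬ N i j ∣ N i r) :
    ∃ N', SmE N N' ∧ SmP i j N' ∧ (N' i j).natDegree < (N i j).natDegree := by
  have hne : r ≠ j := by rintro rfl; exact hr dvd_rfl
  obtain ⟨s, t, hs, ht, hd⟩ : ∃ s t : Polynomial k, (r < j → s.eval 0 = 0) ∧
      (j < r → t.eval 0 = 0) ∧
      (N i j + t * (N i r + s * N i j)).natDegree < (N i j).natDegree := by
    rcases lt_or_gt_of_ne hne with h' | h'
    · obtain ⟨s, t, a, b⟩ := sm_L1 _ _ h.1 hr (h.2.1 _ _ h')
      exact ⟨s, t, fun _ => a, fun h => absurd h h'.asymm, b⟩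
    · obtain ⟨s, t, a, b⟩ := sm_L2 _ _ h.1 hr
      exact ⟨s, t, fun h => absurd h h'.asymm, fun _ => a, b⟩
  have a1 : (Pi.single r s : κ → Polynomial k) j = 0 := by simp [hne.symm]
  have a2 : ∀ l, l < j → ((Pi.single r s : κ → Polynomial k) l).eval 0 = 0 := by
    intro l hl
    by_cases e : l = r
    · subst e; simpa using hs hl
    · simp [e]
  have b1 : (Pi.single j t : κ → Polynomial k) r = 0 := by simp [hne]
  have b2 : ∀ l, l < r → ((Pi.single j t : κ → Polynomial k) l).eval 0 = 0 := by
    intro l hl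
    by_cases e : l = j
    · subst e; simpa using ht hl
    · simp [e]
  refine ⟨_, (SmE.col N j _ a1 a2).trans (SmE.col _ r _ b1 b2), (h.col j _ a1 a2).col r _ b1 b2, ?_⟩
  simpa [hne.symm, mul_comm] using hd

theorem sm_clear (i : ι) (j : κ) : ∀ (d : ℕ) (N : Matrix ι κ (Polynomial k)), SmP i j N →
    (N i j).natDegree = d →
    ∃ N', SmE N N' ∧ (∀ r, r ≠ i → N' r j = 0) ∧ (∀ s, s ≠ j → N' i s = 0) := by
  intro d
  induction d using Nat.strong_induction_on with
  | _ d ih =>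
  intro N hN hd
  by_cases hc : ∃ r, ¬ N i j ∣ N r j
  · obtain ⟨r, hr⟩ := hc
    obtain ⟨N', e, p, lt⟩ := sm_colstep hN r hr
    obtain ⟨N'', e', h⟩ := ih _ (hd ▸ lt) N' p rfl
    exact ⟨N'', e.trans e', h⟩
  by_cases hw : ∃ r, ¬ N i j ∣ N i r
  · obtain ⟨r, hr⟩ := hw
    obtain ⟨N', e, p, lt⟩ := sm_rowstep hN r hr
    obtain ⟨N'', e', h⟩ := ih _ (hd ▸ lt) N' p rfl
    exact ⟨N'', e.trans e', h⟩
  push Not at hc hw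
  choose u hu using hc
  choose v hv using hw
  have a1 : (fun r => if r = i then 0 else - u r) i = 0 := by simp
  have a2 : ∀ l, i < l → ((fun r => if r = i then 0 else - u r) l).eval 0 = 0 := by
    intro l hl
    have := hN.2.2 l hl
    rw [hu, Polynomial.eval_mul] at this
    simpa [hl.ne', hN.1] using this
  have b1 : (fun r => if r = j then 0 else - v r) j = 0 := by simp
  have b2 : ∀ l, l < j → ((fun r => if r = j then 0 else - v r) l).eval 0 = 0 := by
    intro l hl
    have := hN.2.1 i l hl
    rw [hv, Polynomial.eval_mul] at this
    simpa [hl.ne, hN.1] using this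
  refine ⟨_, (SmE.row N i _ a1 a2).trans (SmE.col _ j _ b1 b2), ?_, ?_⟩
  · intro r hr
    have := hu r
    simp [hr]
    linear_combination this
  · intro r hr
    have := hv r
    simp [hr]
    linear_combination this

theorem SmE.smul {M N : Matrix ι κ (Polynomial k)} (h : SmE M N) (c : Polynomial k) :
    SmE (c • M) (c • N) := by
  obtain ⟨U, V, hU, hV, rfl⟩ := h
  exact ⟨U, V, hU, hV, by simp⟩

theorem sm_factor (M : Matrix ι κ (Polynomial k)) (hM : M ≠ 0) :
    ∃ (v : ℕ) (N : Matrix ι κ (Polynomial k)) (i : ι) (j : κ),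
      M = (Polynomial.X ^ v : Polynomial k) • N ∧ SmP i j N := by
  classical
  have hne : (Finset.univ.filter fun x : ι × κ => M x.1 x.2 ≠ 0).Nonempty := by
    by_contra h
    rw [Finset.not_nonempty_iff_eq_empty, Finset.filter_eq_empty_iff] at h
    apply hM
    ext1 r s
    simpa using h (Finset.mem_univ (r, s))
  obtain ⟨⟨i0, j0⟩, h0, hmin⟩ := Finset.exists_min_image _
    (fun x : ι × κ => (M x.1 x.2).natTrailingDegree) hne
  simp only [Finset.mem_filter, Finset.mem_univ, true_and] at h0 hmin
  have hdvd : ∀ r s, Polynomial.X ^ (M i0 j0).natTrailingDegree ∣ M r s := by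
    intro r s
    by_cases h : M r s = 0
    · simp [h]
    rw [Polynomial.X_pow_dvd_iff]
    intro d hd
    exact Polynomial.coeff_eq_zero_of_lt_natTrailingDegree (hd.trans_le (hmin (r, s) h))
  choose N hN using hdvd
  have hN0 : (N i0 j0).eval 0 ≠ 0 := by
    intro h
    have h1 : (M i0 j0).coeff (M i0 j0).natTrailingDegree ≠ 0 :=
      Polynomial.trailingCoeff_nonzero_iff_nonzero.2 h0
    apply h1
    conv_lhs => rw [hN i0 j0]
    have := Polynomial.coeff_X_pow_mul (N i0 j0) (M i0 j0).natTrailingDegree 0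
    rw [zero_add] at this
    rw [← hN i0 j0] at this ⊢
    rw [this, Polynomial.coeff_zero_eq_eval_zero, h]
  obtain ⟨j, hj, hjm⟩ := Finset.exists_min_image
    (Finset.univ.filter fun s : κ => ∃ r, (N r s).eval 0 ≠ 0) id ⟨j0, by simpa using ⟨i0, hN0⟩⟩
  simp only [Finset.mem_filter, Finset.mem_univ, true_and, id] at hj hjm
  obtain ⟨i1, hi1⟩ := hj
  obtain ⟨i, hi, him⟩ := Finset.exists_max_image
    (Finset.univ.filter fun r : ι => (N r j).eval 0 ≠ 0) id ⟨i1, by simpa using hi1⟩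
  simp only [Finset.mem_filter, Finset.mem_univ, true_and, id] at hi him
  refine ⟨(M i0 j0).natTrailingDegree, N, i, j, ?_, hi, ?_, ?_⟩
  · ext1 r s
    exact hN r s
  · intro r s hs
    by_contra h
    exact absurd (hjm s ⟨r, h⟩) (not_le.2 hs)
  · intro r hr
    by_contra h
    exact absurd (him r h) (not_le.2 hr)

/-- extend a matrix on the complement of a row and a column -/
noncomputable def smExt (i : ι) (j : κ) (c : Polynomial k) (A : Matrix {r // ¬ r = i} {s // ¬ s = j} (Polynomial k)) :
    Matrix ι κ (Polynomial k) :=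
  (Matrix.fromBlocks (Matrix.of fun (_ : {r // r = i}) (_ : {s // s = j}) => c) 0 0 A).submatrix
    (Equiv.sumCompl (fun r => r = i)).symm (Equiv.sumCompl (fun s => s = j)).symm

theorem smExt_11 (i : ι) (j : κ) (c : Polynomial k) (A) : smExt i j c A i j = c := by
  simp [smExt, Equiv.sumCompl_symm_apply_of_pos]

theorem smExt_12 (i : ι) (j : κ) (c : Polynomial k) (A) (s) (h : ¬ s = j) :
    smExt i j c A i s = 0 := by
  simp [smExt, Equiv.sumCompl_symm_apply_of_pos, Equiv.sumCompl_symm_apply_of_neg, h]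

theorem smExt_21 (i : ι) (j : κ) (c : Polynomial k) (A) (s) (h : ¬ s = i) :
    smExt i j c A s j = 0 := by
  simp [smExt, Equiv.sumCompl_symm_apply_of_pos, Equiv.sumCompl_symm_apply_of_neg, h]

theorem smExt_22 (i : ι) (j : κ) (c : Polynomial k) (A) (r s) (h : ¬ r = i) (h' : ¬ s = j) :
    smExt i j c A r s = A ⟨r, h⟩ ⟨s, h'⟩ := by
  simp [smExt, Equiv.sumCompl_symm_apply_of_neg, h, h']

theorem smExt_mul {μ : Type} [Fintype μ] [LinearOrder μ] (i : ι) (j : κ) (l : μ)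
    (c d : Polynomial k) (A B) :
    smExt i j c A * smExt j l d B = smExt i l (c * d) (A * B) := by
  rw [smExt, smExt, smExt, Matrix.submatrix_mul_equiv, Matrix.fromBlocks_multiply]
  congr 2
  · ext1 a b
    simp [Matrix.mul_apply]
  all_goals simp

theorem smExt_one (i : ι) : smExt i i (1 : Polynomial k) 1 = 1 := by
  ext1 r s
  by_cases hr : r = i <;> by_cases hs : s = i
  · subst hr; subst hs; simp [smExt_11]
  · subst hr; rw [smExt_12 _ _ _ _ _ hs, Matrix.one_apply_ne (Ne.symm hs)]
  · subst hs; rw [smExt_21 _ _ _ _ _ hr, Matrix.one_apply_ne hr]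
  · rw [smExt_22 _ _ _ _ _ _ hr hs]; simp [Matrix.one_apply]

theorem SmB.ext {i : ι} {A : Matrix {r // ¬ r = i} {r // ¬ r = i} (Polynomial k)} (h : SmB A) :
    SmB (smExt i i 1 A) := by
  obtain ⟨h1, h2, h3⟩ := h
  refine ⟨?_, ?_, ?_⟩
  · obtain ⟨B, hB⟩ := h1.exists_right_inv
    refine IsUnit.of_mul_eq_one (smExt i i 1 B) ?_
    rw [smExt_mul, hB, mul_one]
    convert smExt_one (k := k) i using 2
    ext1 a b
    simp [Matrix.one_apply]
  · intro r
    by_cases hr : r = i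
    · subst hr; simp [smExt_11]
    · rw [smExt_22 _ _ _ _ _ _ hr hr]; exact h2 _
  · intro r s hrs
    by_cases hr : r = i <;> by_cases hs : s = i
    · subst hr; subst hs; exact absurd hrs (lt_irrefl _)
    · subst hr; rw [smExt_12 _ _ _ _ _ hs]; simp
    · subst hs; rw [smExt_21 _ _ _ _ _ hr]; simp
    · rw [smExt_22 _ _ _ _ _ _ hr hs]; exact h3 _ _ hrs

/-- at most one nonzero entry in each row and column -/
def SmR (N : Matrix ι κ (Polynomial k)) : Prop :=
  (∀ i j j', N i j ≠ 0 → N i j' ≠ 0 → j = j') ∧ (∀ i i' j, N i j ≠ 0 → N i' j ≠ 0 → i = i')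

theorem SmR.ext {i : ι} {j : κ} {c : Polynomial k}
    {A : Matrix {r // ¬ r = i} {r // ¬ r = j} (Polynomial k)} (h : SmR A) :
    SmR (smExt i j c A) := by
  refine ⟨?_, ?_⟩
  · intro r s s' h1 h2
    by_cases hr : r = i
    · subst hr
      have e1 : s = j := by by_contra e; exact h1 (smExt_12 _ _ _ _ _ e)
      have e2 : s' = j := by by_contra e; exact h2 (smExt_12 _ _ _ _ _ e)
      rw [e1, e2]
    · have e1 : ¬ s = j := by rintro rfl; exact h1 (smExt_21 _ _ _ _ _ hr)
      have e2 : ¬ s' = j := by rintro rfl; exact h2 (smExt_21 _ _ _ _ _ hr)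
      rw [smExt_22 _ _ _ _ _ _ hr e1] at h1
      rw [smExt_22 _ _ _ _ _ _ hr e2] at h2
      simpa using h.1 _ _ _ h1 h2
  · intro s s' r h1 h2
    by_cases hr : r = j
    · subst hr
      have e1 : s = i := by by_contra e; exact h1 (smExt_21 _ _ _ _ _ e)
      have e2 : s' = i := by by_contra e; exact h2 (smExt_21 _ _ _ _ _ e)
      rw [e1, e2]
    · have e1 : ¬ s = i := by rintro rfl; exact h1 (smExt_12 _ _ _ _ _ hr)
      have e2 : ¬ s' = i := by rintro rfl; exact h2 (smExt_12 _ _ _ _ _ hr)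
      rw [smExt_22 _ _ _ _ _ _ e1 hr] at h1
      rw [smExt_22 _ _ _ _ _ _ e2 hr] at h2
      simpa using h.2 _ _ _ h1 h2

theorem SmR.smul {N : Matrix ι κ (Polynomial k)} (h : SmR N) (c : Polynomial k) : SmR (c • N) :=
  ⟨fun i j j' h1 h2 => h.1 i j j' (right_ne_zero_of_mul h1) (right_ne_zero_of_mul h2),
   fun i j j' h1 h2 => h.2 i j j' (right_ne_zero_of_mul h1) (right_ne_zero_of_mul h2)⟩

end

theorem sm_main {k : Type*} [Field k] : ∀ (n : ℕ) (ι κ : Type) [Fintype ι] [LinearOrder ι]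
    [Fintype κ] [LinearOrder κ] (M : Matrix ι κ (Polynomial k)), Fintype.card ι = n →
    ∃ N, SmE M N ∧ SmR N := by
  intro n
  induction n with
  | zero =>
    intro ι κ _ _ _ _ M h
    have := Fintype.card_eq_zero_iff.1 h
    exact ⟨M, SmE.refl M, fun i => isEmptyElim i, fun i => isEmptyElim i⟩
  | succ n ih =>
    intro ι κ _ _ _ _ M h
    by_cases hM : M = 0
    · exact ⟨M, SmE.refl M, by simp [hM, SmR]⟩
    obtain ⟨v, N, i, j, rfl, hP⟩ := sm_factor M hM
    obtain ⟨N', hE, hc, hr⟩ := sm_clear i j _ N hP rfl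
    obtain ⟨A, ⟨U, V, hU, hV, hA⟩, hR⟩ := ih {r // ¬ r = i} {s // ¬ s = j}
      (Matrix.of fun r s => N' r.1 s.1) (by
        rw [Fintype.card_subtype_compl, h]; simp)
    refine ⟨Polynomial.X ^ v • smExt i j (N' i j) A, (hE.trans ?_).smul _, hR.ext.smul _⟩
    refine ⟨_, _, hU.ext, hV.ext, ?_⟩
    rw [smExt_mul, smExt_mul, ← hA]
    ext1 r s
    by_cases h1 : r = i <;> by_cases h2 : s = j
    · subst h1; subst h2; simp [smExt_11]
    · subst h1; rw [smExt_12 _ _ _ _ _ h2, hr _ h2]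
    · subst h2; rw [smExt_21 _ _ _ _ _ h1, hc _ h1]
    · rw [smExt_22 _ _ _ _ _ _ h1 h2]; rfl

theorem sm_perm {k : Type*} [Field k] {n : ℕ} (N : Matrix (Fin n) (Fin n) (Polynomial k))
    (h : SmR N) : ∃ (σ : Equiv.Perm (Fin n)) (D : Fin n → Polynomial k),
    N = Matrix.diagonal D *
        (Matrix.of fun i j : Fin n => if σ i = j then (1 : Polynomial k) else 0) := by
  classical
  have : ∀ i, ∃ j, (∃ l, N i l ≠ 0) → N i j ≠ 0 := by
    intro i
    by_cases hi : ∃ l, N i l ≠ 0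
    · obtain ⟨l, hl⟩ := hi
      exact ⟨l, fun _ => hl⟩
    · exact ⟨i, fun h => absurd h hi⟩
  choose f hf using this
  obtain ⟨g, hg⟩ := Finset.exists_equiv_extend_of_card_eq (α := Fin n) (β := Fin n)
    (t := Finset.univ) (by simp) (s := Finset.univ.filter fun i => ∃ l, N i l ≠ 0) (f := f)
    (Finset.subset_univ _) (by
      intro a ha b hb hab
      simp only [Finset.coe_filter, Finset.mem_univ, true_and, Set.mem_ofPred_eq] at ha hb
      have h1 := hf a ha
      have h2 := hf b hb
      rw [← hab] at h2
      exact h.2 _ _ _ h1 h2)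
  refine ⟨g.trans (Equiv.subtypeUnivEquiv (by simp)), fun i => N i (g i), ?_⟩
  ext1 i j
  rw [Matrix.diagonal_mul]
  simp only [Matrix.of_apply, Equiv.trans_apply, Equiv.subtypeUnivEquiv_apply, mul_ite, mul_one,
    mul_zero]
  split_ifs with e
  · rw [e]
  · by_contra h'
    have hi : ∃ l, N i l ≠ 0 := ⟨j, h'⟩
    have h1 := hg i (by simpa using hi)
    apply e
    rw [h1]
    exact h.1 _ _ _ (hf i hi) h'


/-- Modified Smith form: For every `M ∈ M_n(k[x])` there exist `U, V ∈ B_n`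
(invertible over `k[x]` with `U(0), V(0)` upper unitriangular), a permutation `σ ∈ S_n`, and
a diagonal matrix `D` with `M = U · D · M_σ · V`, where `(M_σ)_{ij} = δ_{σ(i),j}`. -/
theorem stmt8 {k : Type*} [Field k] (n : ℕ) (hn : 1 ≤ n)
    (M : Matrix (Fin n) (Fin n) (Polynomial k)) :
    ∃ (U V : Matrix (Fin n) (Fin n) (Polynomial k)) (σ : Equiv.Perm (Fin n))
      (D : Fin n → Polynomial k),
      IsUnit U ∧ IsUnit V ∧
      (∀ i : Fin n, (U i i).eval 0 = 1) ∧ (∀ i j : Fin n, j < i → (U i j).eval 0 = 0) ∧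
      (∀ i : Fin n, (V i i).eval 0 = 1) ∧ (∀ i j : Fin n, j < i → (V i j).eval 0 = 0) ∧
      M = U * Matrix.diagonal D *
        (Matrix.of fun i j : Fin n => if σ i = j then (1 : Polynomial k) else 0) * V := by
  obtain ⟨N, ⟨U, V, hU, hV, hM⟩, hR⟩ := sm_main n (Fin n) (Fin n) M (by simp)
  obtain ⟨σ, D, hN⟩ := sm_perm N hR
  refine ⟨U, V, σ, D, hU.1, hV.1, hU.2.1, hU.2.2, hV.2.1, hV.2.2, ?_⟩
  rw [hM, hN, ← Matrix.mul_assoc U]
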